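/- For n ≥ 5, the Rellich inequality ∫_{ℝⁿ} |Δu|² dx ≥ (n²(n−4)²/16) ∫_{ℝⁿ} |u|²/|x|⁴ dx holds for all real-valued u ∈ C^∞_c(ℝⁿ \ {0}). -/

import Mathlib

open MeasureTheory

/-- The Laplacian of `f` at `x` as the sum of second partial derivatives. -/
noncomputable def elap {n : ℕ} (f : EuclideanSpace ℝ (Fin n) → ℝ)
    (x : EuclideanSpace ℝ (Fin n)) : ℝ :=
  ∑ i, fderiv ℝ (fun y => fderiv ℝ f y (EuclideanSpace.single i 1)) x
    (EuclideanSpace.single i 1)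

/-- The integral of a directional derivative of a compactly supported `C¹` function vanishes. -/
theorem integral_fderiv_apply_eq_zero {E : Type*} [NormedAddCommGroup E] [NormedSpace ℝ E]
    [FiniteDimensional ℝ E] [MeasurableSpace E] [BorelSpace E] (μ : Measure E)
    [μ.IsAddHaarMeasure] {f : E → ℝ} (hf : ContDiff ℝ 1 f) (hfs : HasCompactSupport f) (v : E) :
    Integrable (fun x => fderiv ℝ f x v) μ ∧ ∫ x, fderiv ℝ f x v ∂μ = 0 := by
  have hc : Continuous fun x => fderiv ℝ f x v :=
    (hf.continuous_fderiv one_ne_zero).clm_apply continuous_const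
  have hi : Integrable (fun x => fderiv ℝ f x v) μ :=
    hc.integrable_of_hasCompactSupport (hfs.fderiv_apply ℝ v)
  refine ⟨hi, ?_⟩
  simpa using integral_mul_fderiv_eq_neg_fderiv_mul_of_integrable (μ := μ) (v := v)
    (f := fun _ => (1 : ℝ)) (g := f) (by simp) (by simpa using hi)
    (by simpa using hf.continuous.integrable_of_hasCompactSupport hfs)
    (by fun_prop) (fun x _ => hf.differentiable one_ne_zero x)

/-- The `i`-th component of the vector field `u ∇u / |x|² + a u² x / |x|⁴`. -/
noncomputable def rellichField {n : ℕ} (a : ℝ) (u : EuclideanSpace ℝ (Fin n) → ℝ) (i : Fin n)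
    (x : EuclideanSpace ℝ (Fin n)) : ℝ :=
  u x * (fderiv ℝ u x (EuclideanSpace.single i 1) * (‖x‖ ^ 2)⁻¹
    + a * (u x * (x i * ((‖x‖ ^ 2)⁻¹) ^ 2)))

theorem tsupport_rellichField_subset {n : ℕ} (a : ℝ) (u : EuclideanSpace ℝ (Fin n) → ℝ)
    (i : Fin n) : tsupport (rellichField a u i) ⊆ tsupport u :=
  tsupport_mul_subset_left

theorem contDiff_rellichField {n : ℕ} (a : ℝ) {u : EuclideanSpace ℝ (Fin n) → ℝ}
    (hu : ContDiff ℝ 2 u) (h0 : tsupport u ⊆ {(0 : EuclideanSpace ℝ (Fin n))}ᶜ) (i : Fin n) :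
    ContDiff ℝ 1 (rellichField a u i) := by
  refine contMDiff_iff_contDiff.1
    (contMDiff_of_tsupport fun x hx => ContDiffAt.contMDiffAt ?_)
  have hx0 : ‖x‖ ^ 2 ≠ 0 :=
    pow_ne_zero 2 (norm_ne_zero_iff.2 (h0 (tsupport_rellichField_subset a u i hx)))
  have h1 : ContDiffAt ℝ 1 u x := (hu.of_le one_le_two).contDiffAt
  have h2 : ContDiffAt ℝ 1 (fun y => fderiv ℝ u y (EuclideanSpace.single i 1)) x :=
    ((hu.fderiv_right (m := 1) (by norm_num)).clm_apply contDiff_const).contDiffAt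
  have h3 : ContDiffAt ℝ 1 (fun y : EuclideanSpace ℝ (Fin n) => (‖y‖ ^ 2)⁻¹) x :=
    (contDiff_norm_sq ℝ).contDiffAt.inv hx0
  have h4 : ContDiffAt ℝ 1 (fun y : EuclideanSpace ℝ (Fin n) => y i) x :=
    (EuclideanSpace.proj (𝕜 := ℝ) i).contDiff.contDiffAt
  exact h1.mul ((h2.mul h3).add (contDiffAt_const.mul (h1.mul (h4.mul (h3.pow 2)))))

theorem fderiv_rellichField_apply {n : ℕ} (a : ℝ) {u : EuclideanSpace ℝ (Fin n) → ℝ}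
    (hu : ContDiff ℝ 2 u) {x : EuclideanSpace ℝ (Fin n)} (hx : x ≠ 0) (i : Fin n) :
    fderiv ℝ (rellichField a u i) x (EuclideanSpace.single i 1) =
      (‖x‖ ^ 2)⁻¹ * fderiv ℝ u x (EuclideanSpace.single i 1) ^ 2
      + (2 * a - 2) * u x * ((‖x‖ ^ 2)⁻¹) ^ 2 * (x i * fderiv ℝ u x (EuclideanSpace.single i 1))
      + u x * (‖x‖ ^ 2)⁻¹ *
        fderiv ℝ (fun y => fderiv ℝ u y (EuclideanSpace.single i 1)) x (EuclideanSpace.single i 1)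
      - 4 * a * u x ^ 2 * ((‖x‖ ^ 2)⁻¹) ^ 3 * x i ^ 2
      + a * u x ^ 2 * ((‖x‖ ^ 2)⁻¹) ^ 2 := by
  have hx0 : ‖x‖ ^ 2 ≠ 0 := pow_ne_zero 2 (norm_ne_zero_iff.2 hx)
  have h1 : HasFDerivAt u (fderiv ℝ u x) x := (hu.differentiable two_ne_zero x).hasFDerivAt
  have h2 : HasFDerivAt (fun y => fderiv ℝ u y (EuclideanSpace.single i 1))
      (fderiv ℝ (fun y => fderiv ℝ u y (EuclideanSpace.single i 1)) x) x :=
    (((hu.fderiv_right (m := 1) (by norm_num)).clm_apply contDiff_const).differentiable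
      one_ne_zero x).hasFDerivAt
  have h3 : HasFDerivAt (fun y : EuclideanSpace ℝ (Fin n) => (‖y‖ ^ 2)⁻¹) _ x :=
    (hasDerivAt_inv hx0).comp_hasFDerivAt x (hasStrictFDerivAt_norm_sq x).hasFDerivAt
  have h4 : HasFDerivAt (fun y : EuclideanSpace ℝ (Fin n) => y i)
      (EuclideanSpace.proj (𝕜 := ℝ) i) x := (EuclideanSpace.proj (𝕜 := ℝ) i).hasFDerivAt
  have h := h1.mul ((h2.mul h3).add ((h1.mul (h4.mul (h3.pow 2))).const_mul a))
  have hF : fderiv ℝ (rellichField a u i) x = _ := h.fderiv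
  rw [hF]
  simp [EuclideanSpace.inner_single_right]
  field_simp
  ring

theorem rellich_divergence_nonneg {n : ℕ} (hn : 4 ≤ n) {u : EuclideanSpace ℝ (Fin n) → ℝ}
    (hu : ContDiff ℝ 2 u) {x : EuclideanSpace ℝ (Fin n)} (hx : x ≠ 0) :
    0 ≤ elap u x ^ 2 - (n : ℝ) ^ 2 * ((n : ℝ) - 4) ^ 2 / 16 * (u x ^ 2 / ‖x‖ ^ 4)
      + (n : ℝ) * ((n : ℝ) - 4) / 2 *
        ∑ i, fderiv ℝ (rellichField (((n : ℝ) - 2) / 2) u i) x (EuclideanSpace.single i 1) := by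
  simp_rw [fderiv_rellichField_apply _ hu hx]
  simp only [Finset.sum_add_distrib, Finset.sum_sub_distrib, ← Finset.mul_sum, Finset.sum_const,
    Finset.card_univ, Fintype.card_fin, nsmul_eq_mul]
  change 0 ≤ elap u x ^ 2 - _ + _ * (_ + _ + _ * elap u x - _ + _)
  have hn' : (4 : ℝ) ≤ n := by exact_mod_cast hn
  have hR : ∑ i, x i ^ 2 = ‖x‖ ^ 2 := (EuclideanSpace.real_norm_sq_eq x).symm
  have hx0 : ‖x‖ ≠ 0 := norm_ne_zero_iff.2 hx
  have hsq : 0 ≤ ∑ i, (fderiv ℝ u x (EuclideanSpace.single i 1)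
      + ((n : ℝ) - 4) / 2 * u x * (‖x‖ ^ 2)⁻¹ * x i) ^ 2 :=
    Finset.sum_nonneg fun i _ => sq_nonneg _
  have hexp : ∑ i, (fderiv ℝ u x (EuclideanSpace.single i 1)
      + ((n : ℝ) - 4) / 2 * u x * (‖x‖ ^ 2)⁻¹ * x i) ^ 2 =
      ∑ i, fderiv ℝ u x (EuclideanSpace.single i 1) ^ 2
      + ((n : ℝ) - 4) * u x * (‖x‖ ^ 2)⁻¹ *
        ∑ i, x i * fderiv ℝ u x (EuclideanSpace.single i 1)
      + (((n : ℝ) - 4) / 2 * u x * (‖x‖ ^ 2)⁻¹) ^ 2 * ∑ i, x i ^ 2 := by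
    simp only [Finset.mul_sum, ← Finset.sum_add_distrib]
    exact Finset.sum_congr rfl fun i _ => by ring
  rw [hexp, hR] at hsq
  rw [hR]
  have hc : 0 ≤ (n : ℝ) * ((n : ℝ) - 4) / 2 * (‖x‖ ^ 2)⁻¹ := by
    have : 0 ≤ (n : ℝ) - 4 := by linarith
    positivity
  refine (add_nonneg (sq_nonneg (elap u x + (n : ℝ) * ((n : ℝ) - 4) / 4 * u x * (‖x‖ ^ 2)⁻¹))
    (mul_nonneg hc hsq)).trans_eq ?_
  field_simp
  ring

/-- Classical Rellich inequality: for `n ≥ 5` and `u ∈ C^∞_c(ℝⁿ \ {0})`,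
`∫ |Δu|² ≥ (n²(n−4)²/16) ∫ u²/|x|⁴`. -/
theorem rellich_classical {n : ℕ} (hn : 5 ≤ n)
    (u : EuclideanSpace ℝ (Fin n) → ℝ)
    (hu : ContDiff ℝ (⊤ : ℕ∞) u) (hucs : HasCompactSupport u)
    (h0 : tsupport u ⊆ {(0 : EuclideanSpace ℝ (Fin n))}ᶜ) :
    (n : ℝ) ^ 2 * ((n : ℝ) - 4) ^ 2 / 16 * ∫ x, u x ^ 2 / ‖x‖ ^ 4
      ≤ ∫ x, (elap u x) ^ 2 := by
  have hu2 : ContDiff ℝ 2 u := contDiff_infty.1 hu 2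
  have hF := fun i => integral_fderiv_apply_eq_zero volume
    (contDiff_rellichField (((n : ℝ) - 2) / 2) hu2 h0 i)
    (hucs.mono' (subset_closure.trans (tsupport_rellichField_subset _ u i)))
    (EuclideanSpace.single i 1)
  have hL : Integrable fun x => elap u x ^ 2 := by
    have hd : ∀ i : Fin n, ContDiff ℝ 1 fun y => fderiv ℝ u y (EuclideanSpace.single i 1) :=
      fun i => (hu2.fderiv_right (m := 1) (by norm_num)).clm_apply contDiff_const
    have hc : Continuous (elap u) := by
      unfold elap
      exact continuous_finsetSum _ fun i _ =>
        ((hd i).continuous_fderiv one_ne_zero).clm_apply continuous_const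
    refine (hc.pow 2).integrable_of_hasCompactSupport (hucs.mono' fun x hx => ?_)
    contrapose! hx
    have h : ∀ i : Fin n, fderiv ℝ (fun y => fderiv ℝ u y (EuclideanSpace.single i 1)) x
        (EuclideanSpace.single i 1) = 0 := fun i =>
      image_eq_zero_of_notMem_tsupport
        (f := fun x => fderiv ℝ (fun y => fderiv ℝ u y (EuclideanSpace.single i 1)) x
          (EuclideanSpace.single i 1))
        fun hx' => hx <|
          tsupport_fderiv_apply_subset ℝ _ (tsupport_fderiv_apply_subset ℝ _ hx')
    simp [elap, h]
  have hU : Integrable fun x => u x ^ 2 / ‖x‖ ^ 4 := by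
    have hs : tsupport (fun x => u x ^ 2 / ‖x‖ ^ 4) ⊆ tsupport u :=
      closure_mono fun x hx hux => hx (by simp [hux])
    refine (continuous_of_tsupport fun x hx => ?_).integrable_of_hasCompactSupport
      (hucs.mono' (subset_closure.trans hs))
    exact (hu2.continuous.continuousAt.pow 2).div (continuousAt_id.norm.pow 4)
      (pow_ne_zero 4 (norm_ne_zero_iff.2 (h0 (hs hx))))
  have hS : Integrable fun x => ∑ i, fderiv ℝ (rellichField (((n : ℝ) - 2) / 2) u i) x
      (EuclideanSpace.single i 1) := integrable_finsetSum _ fun i _ => (hF i).1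
  have key : 0 ≤ ∫ x, (elap u x ^ 2 - (n : ℝ) ^ 2 * ((n : ℝ) - 4) ^ 2 / 16 * (u x ^ 2 / ‖x‖ ^ 4)
      + (n : ℝ) * ((n : ℝ) - 4) / 2 *
        ∑ i, fderiv ℝ (rellichField (((n : ℝ) - 2) / 2) u i) x (EuclideanSpace.single i 1)) := by
    refine integral_nonneg fun x => ?_
    by_cases hx : x ∈ tsupport u
    · exact rellich_divergence_nonneg (by omega) hu2 (h0 hx)
    · have h : ∀ i : Fin n, fderiv ℝ (rellichField (((n : ℝ) - 2) / 2) u i) x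
          (EuclideanSpace.single i 1) = 0 := fun i =>
        image_eq_zero_of_notMem_tsupport
          (f := fun x => fderiv ℝ (rellichField (((n : ℝ) - 2) / 2) u i) x
            (EuclideanSpace.single i 1))
          fun hx' => hx <| tsupport_rellichField_subset _ u i (tsupport_fderiv_apply_subset ℝ _ hx')
      simp [h, image_eq_zero_of_notMem_tsupport hx, sq_nonneg]
  have hLU : Integrable fun x =>
      elap u x ^ 2 - (n : ℝ) ^ 2 * ((n : ℝ) - 4) ^ 2 / 16 * (u x ^ 2 / ‖x‖ ^ 4) :=
    hL.sub (hU.const_mul _)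
  rw [integral_add hLU (hS.const_mul _),
    integral_sub hL (hU.const_mul _), integral_const_mul, integral_const_mul,
    integral_finsetSum _ fun i _ => (hF i).1, Finset.sum_eq_zero fun i _ => (hF i).2] at key
  linarith
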